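/- arXiv:1908.02888 — 8 statements merged into one kernel-verified Lean document; each statement's English description precedes it below -/
import Mathlib

section
/- Let h and α be real constants with 1/2 < h < 1 and α ≥ h/2. Then for all real numbers x, y with 0 < x < y, one has α·(y^{-h} - x^{-h}) + (h/2)·(x^{h-1} - y^{h-1} + x^{1-h} - y^{1-h}) ≤ 0. -/
open Real

lemma one_sub_mul_rpow_sub_self_le {h t : ℝ} (hh1 : 1 / 2 < h) (hh2 : h < 1) (ht : 0 < t) :
    (1 - h) * (t ^ (2 * h - 1) - t) ≤ h := by
  rcases le_total t 1 with h1 | h1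
  · have := rpow_le_one ht.le h1 (show 0 ≤ 2 * h - 1 by linarith)
    nlinarith
  · have := rpow_le_rpow_of_exponent_le h1 (show 2 * h - 1 ≤ 1 by linarith)
    rw [rpow_one] at this
    nlinarith

lemma antitoneOn_rpow_combination {h α : ℝ} (hh1 : 1 / 2 < h) (hh2 : h < 1) (hα : h / 2 ≤ α) :
    AntitoneOn (fun t : ℝ ↦ α * t ^ (-h) - h / 2 * (t ^ (h - 1) + t ^ (1 - h))) (Set.Ioi 0) := by
  have hderiv : ∀ t ∈ Set.Ioi (0 : ℝ),
      HasDerivAt (fun t : ℝ ↦ α * t ^ (-h) - h / 2 * (t ^ (h - 1) + t ^ (1 - h)))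
        (α * (-h * t ^ (-h - 1)) -
          h / 2 * ((h - 1) * t ^ (h - 1 - 1) + (1 - h) * t ^ (1 - h - 1))) t := by
    intro t ht
    have hne : t ≠ 0 := ne_of_gt ht
    exact ((hasDerivAt_rpow_const (Or.inl hne)).const_mul α).sub
      (((hasDerivAt_rpow_const (Or.inl hne)).add
        (hasDerivAt_rpow_const (Or.inl hne))).const_mul (h / 2))
  refine antitoneOn_of_deriv_nonpos (convex_Ioi 0)
    (fun t ht ↦ (hderiv t ht).continuousAt.continuousWithinAt) ?_ ?_ <;> rw [interior_Ioi]
  · exact fun t ht ↦ (hderiv t ht).differentiableAt.differentiableWithinAt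
  · intro t ht
    rw [(hderiv t ht).deriv]
    have ht0 : 0 < t := ht
    have e1 : t ^ (h - 1 - 1) = t ^ (-h - 1) * t ^ (2 * h - 1) := by
      rw [← rpow_add ht0]; ring_nf
    have e2 : t ^ (1 - h - 1) = t ^ (-h - 1) * t := by
      rw [← rpow_add_one ht0.ne']; ring_nf
    have hbound := one_sub_mul_rpow_sub_self_le hh1 hh2 ht0
    have hP : 0 ≤ h * t ^ (-h - 1) := mul_nonneg (by linarith) (rpow_nonneg ht0.le _)
    have := mul_nonneg hP
      (show 0 ≤ α - (1 - h) * (t ^ (2 * h - 1) - t) / 2 by linarith)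
    rw [e1, e2]
    linarith

theorem stmt_0 (h α : ℝ) (hh1 : 1/2 < h) (hh2 : h < 1) (hα : h/2 ≤ α)
    (x y : ℝ) (hx : 0 < x) (hxy : x < y) :
    α * (y ^ (-h) - x ^ (-h)) +
      (h/2) * (x ^ (h-1) - y ^ (h-1) + x ^ (1-h) - y ^ (1-h)) ≤ 0 := by
  have := antitoneOn_rpow_combination hh1 hh2 hα hx (hx.trans hxy) hxy.le
  dsimp only at this
  linarith
end

section
/- Let h be a real constant with 1/2 < h < 1, define w(z) = z^{h-1} - z^{-h} for z > 0, and set z₀ = (h/(1-h))^{1/(2h-1)}. Then z₀ > 1, w is strictly increasing on (0, z₀], and w is strictly decreasing on [z₀, ∞). -/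
open Real Set

theorem hasDerivAt_rpow_sub_rpow_neg (h : ℝ) {z : ℝ} (hz : 0 < z) :
    HasDerivAt (fun z : ℝ => z ^ (h-1) - z ^ (-h))
      (z ^ (-h-1) * (h - (1-h) * z ^ (2*h-1))) z := by
  have hd := (Real.hasDerivAt_rpow_const (p := h-1) (Or.inl hz.ne')).sub
    (Real.hasDerivAt_rpow_const (p := -h) (Or.inl hz.ne'))
  refine hd.congr_deriv ?_
  have he : z ^ (h-1-1) = z ^ (-h-1) * z ^ (2*h-1) := by
    rw [← Real.rpow_add hz]
    ring_nf
  rw [he]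
  ring

theorem stmt_1 (h : ℝ) (hh1 : 1/2 < h) (hh2 : h < 1) :
    let w : ℝ → ℝ := fun z => z ^ (h-1) - z ^ (-h)
    let z₀ : ℝ := (h / (1-h)) ^ (1 / (2*h - 1))
    1 < z₀ ∧ StrictMonoOn w (Set.Ioc 0 z₀) ∧ StrictAntiOn w (Set.Ici z₀) := by
  intro w z₀
  have hk : 0 < 2*h-1 := by linarith
  have hc : 0 < 1-h := by linarith
  have hr : 1 < h / (1-h) := by rw [lt_div_iff₀ hc]; linarith
  have hz₀ : 1 < z₀ := Real.one_lt_rpow hr (by positivity)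
  have hpow : z₀ ^ (2*h-1) = h / (1-h) := by
    simp only [z₀, one_div]
    exact Real.rpow_inv_rpow (by linarith) hk.ne'
  have hw : ∀ z : ℝ, 0 < z → HasDerivAt w (z ^ (-h-1) * (h - (1-h) * z ^ (2*h-1))) z :=
    fun z hz => hasDerivAt_rpow_sub_rpow_neg h hz
  refine ⟨hz₀, ?_, ?_⟩
  · refine strictMonoOn_of_deriv_pos (convex_Ioc 0 z₀)
      (fun z hz => (hw z hz.1).continuousAt.continuousWithinAt) fun z hz => ?_
    rw [interior_Ioc] at hz
    rw [(hw z hz.1).deriv]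
    have hlt := Real.rpow_lt_rpow hz.1.le hz.2 hk
    rw [hpow, lt_div_iff₀ hc] at hlt
    exact mul_pos (Real.rpow_pos_of_pos hz.1 _) (by linarith)
  · refine strictAntiOn_of_deriv_neg (convex_Ici z₀)
      (fun z hz => (hw z ((zero_lt_one.trans hz₀).trans_le hz)).continuousAt.continuousWithinAt)
      fun z hz => ?_
    rw [interior_Ici] at hz
    have hz0 : 0 < z := (zero_lt_one.trans hz₀).trans hz
    rw [(hw z hz0).deriv]
    have hlt := Real.rpow_lt_rpow (zero_lt_one.trans hz₀).le hz hk
    rw [hpow, div_lt_iff₀ hc] at hlt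
    exact mul_neg_of_pos_of_neg (Real.rpow_pos_of_pos hz0 _) (by linarith)
end

section
/- Let h be a real constant with 1/2 < h < 1 and let n ≥ 1 be an integer. Define φₙ : [0,∞) → ℝ by φₙ(x) = 1/(2(h+1)n) for x ≥ 1/n, and φₙ(x) = (n^{2h+1}/(2(h+1)))·(1/n - x)^{2(h+1)} + 1/(2(h+1)n) for 0 ≤ x < 1/n. Then φₙ is twice continuously differentiable on [0,∞), and for all x ≥ 0: 0 ≤ φₙ(x) ≤ 1/(h+1), |φₙ'(x)| ≤ 1, and |φₙ''(x)·x^{2h}| ≤ 2h+1. Moreover, for every fixed x ≥ 0, as n → ∞: φₙ(x) → 0, φₙ'(x) → -𝟙_{{0}}(x) (i.e. the limit is -1 if x = 0 and 0 if x > 0), and φₙ''(x)·x^{2h} → 0. -/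
open Real Set Filter Topology

/-- The auxiliary piecewise function `φₙ` used in Lemma 3.1. -/
noncomputable def phiAux (h : ℝ) (n : ℕ) (x : ℝ) : ℝ :=
  if (1 : ℝ)/n ≤ x then 1 / (2*(h+1)*n)
  else (n : ℝ) ^ (2*h+1) / (2*(h+1)) * (1/n - x) ^ (2*(h+1)) + 1 / (2*(h+1)*n)

theorem hasDerivAt_max_zero_rpow {p : ℝ} (hp : 1 < p) (y : ℝ) :
    HasDerivAt (fun y : ℝ => max y 0 ^ p) (p * max y 0 ^ (p - 1)) y := by
  have h0 : (0 : ℝ) ^ p = 0 := zero_rpow (by linarith)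
  have h1 : (0 : ℝ) ^ (p - 1) = 0 := zero_rpow (by linarith)
  rcases lt_trichotomy y 0 with hy | rfl | hy
  · rw [max_eq_right hy.le, h1, mul_zero]
    refine (hasDerivAt_const y (0 : ℝ)).congr_of_eventuallyEq ?_
    filter_upwards [Iio_mem_nhds hy] with z hz
    rw [max_eq_right (le_of_lt hz), h0]
  · rw [← hasDerivWithinAt_univ, ← Iic_union_Ici (a := (0 : ℝ)), max_self]
    refine HasDerivWithinAt.union ?_ ?_
    · rw [h1, mul_zero]
      refine (hasDerivWithinAt_const (0 : ℝ) _ (0 : ℝ)).congr (fun z hz => ?_) ?_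
      · rw [max_eq_right hz, h0]
      · rw [max_self, h0]
    · refine (hasDerivAt_rpow_const (Or.inr hp.le)).hasDerivWithinAt.congr (fun z hz => ?_) ?_
      · rw [max_eq_left hz]
      · rw [max_self]
  · rw [max_eq_left hy.le]
    refine (hasDerivAt_rpow_const (Or.inr hp.le)).congr_of_eventuallyEq ?_
    filter_upwards [Ioi_mem_nhds hy] with z hz
    rw [max_eq_left (le_of_lt hz)]

theorem hasDerivAt_max_sub_zero_rpow {p : ℝ} (hp : 1 < p) (c x : ℝ) :
    HasDerivAt (fun x : ℝ => max (c - x) 0 ^ p) (-(p * max (c - x) 0 ^ (p - 1))) x := by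
  refine ((hasDerivAt_max_zero_rpow hp (c - x)).comp x
    ((hasDerivAt_id x).const_sub c)).congr_deriv ?_
  rw [mul_neg_one]

theorem phiAux_eq_max {h : ℝ} (hh : -1 < h) (n : ℕ) (x : ℝ) :
    phiAux h n x = (n : ℝ) ^ (2*h+1) / (2*(h+1)) * max (1/n - x) 0 ^ (2*(h+1))
      + 1 / (2*(h+1)*n) := by
  unfold phiAux
  split_ifs with hx
  · rw [max_eq_right (by linarith), zero_rpow (by linarith)]
    ring
  · rw [max_eq_left (by linarith)]

theorem natCast_mul_max_le_one {n : ℕ} {x : ℝ} (hx : 0 ≤ x) :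
    n * max (1/(n : ℝ) - x) 0 ≤ 1 := by
  have hn : (0 : ℝ) ≤ n := n.cast_nonneg
  calc n * max (1/(n : ℝ) - x) 0 ≤ n * (1/n) := by
        gcongr
        exact max_le (by linarith) (by positivity)
    _ ≤ 1 := by rw [mul_one_div]; exact div_self_le_one _

theorem rpow_mul_max_rpow_le_one {n : ℕ} {x p : ℝ} (hx : 0 ≤ x) (hp : 0 ≤ p) :
    (n : ℝ) ^ p * max (1/(n : ℝ) - x) 0 ^ p ≤ 1 := by
  have hm : 0 ≤ max (1/(n : ℝ) - x) 0 := le_max_right _ _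
  rw [← mul_rpow n.cast_nonneg hm]
  exact rpow_le_one (by positivity) (natCast_mul_max_le_one hx) hp

theorem phiAux_nonneg {h : ℝ} (hh : -1 < h) (n : ℕ) (x : ℝ) : 0 ≤ phiAux h n x := by
  have hm : 0 ≤ max (1/(n : ℝ) - x) 0 := le_max_right _ _
  have hh' : 0 < h + 1 := by linarith
  rw [phiAux_eq_max hh]
  positivity

theorem phiAux_le {h : ℝ} (hh : -1/2 ≤ h) {n : ℕ} (hn : 1 ≤ n) {x : ℝ} (hx : 0 ≤ x) :
    phiAux h n x ≤ 1 / (h+1) * (1 / n) := by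
  have hn' : (0 : ℝ) < n := by exact_mod_cast hn
  have hh' : 0 < h + 1 := by linarith
  have hm : 0 ≤ max (1/(n : ℝ) - x) 0 := le_max_right _ _
  have hmn : max (1/(n : ℝ) - x) 0 ≤ 1/n := max_le (by linarith) (by positivity)
  have hsplit : max (1/(n : ℝ) - x) 0 ^ (2*(h+1))
      = max (1/(n : ℝ) - x) 0 ^ (2*h+1) * max (1/(n : ℝ) - x) 0 := by
    rw [show 2*(h+1) = (2*h+1) + 1 by ring, rpow_add_one' hm (by linarith)]
  have hle := rpow_mul_max_rpow_le_one (n := n) (p := 2*h+1) hx (by linarith)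
  rw [phiAux_eq_max (by linarith), hsplit]
  calc (n : ℝ) ^ (2*h+1) / (2*(h+1)) * (max (1/(n : ℝ) - x) 0 ^ (2*h+1) * max (1/(n : ℝ) - x) 0)
        + 1 / (2*(h+1)*n)
      = ((n : ℝ) ^ (2*h+1) * max (1/(n : ℝ) - x) 0 ^ (2*h+1)) * max (1/(n : ℝ) - x) 0
          / (2*(h+1)) + 1 / (2*(h+1)*n) := by ring
    _ ≤ 1 * (1/n) / (2*(h+1)) + 1 / (2*(h+1)*n) := by gcongr
    _ = 1 / (h+1) * (1 / n) := by field_simp; ring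

theorem rpow_mul_max_rpow_mul_rpow_le_one {h : ℝ} (hh : 1/2 ≤ h) {n : ℕ} (hn : 1 ≤ n) {x : ℝ}
    (hx : 0 ≤ x) :
    (n : ℝ) ^ (2*h+1) * max (1/(n : ℝ) - x) 0 ^ (2*h) * x ^ (2*h) ≤ 1 := by
  have hn1 : (1 : ℝ) ≤ n := by exact_mod_cast hn
  have hn0 : (0 : ℝ) < n := by linarith
  rcases le_total (1/(n : ℝ)) x with hc | hc
  · rw [max_eq_right (by linarith), zero_rpow (by linarith)]
    simp
  have hm : 0 ≤ max (1/(n : ℝ) - x) 0 := le_max_right _ _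
  have hle := rpow_mul_max_rpow_le_one (n := n) (p := 2*h) hx (by linarith)
  have hx2 : x ^ (2*h) ≤ 1/n := calc
    x ^ (2*h) ≤ (1/(n : ℝ)) ^ (2*h) := rpow_le_rpow hx hc (by linarith)
    _ ≤ (1/(n : ℝ)) ^ (1 : ℝ) := rpow_le_rpow_of_exponent_ge (by positivity)
        ((div_le_one hn0).2 hn1) (by linarith)
    _ = 1/n := rpow_one _
  calc (n : ℝ) ^ (2*h+1) * max (1/(n : ℝ) - x) 0 ^ (2*h) * x ^ (2*h)
      = ((n : ℝ) ^ (2*h) * max (1/(n : ℝ) - x) 0 ^ (2*h)) * (n * x ^ (2*h)) := by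
        rw [rpow_add_one hn0.ne']; ring
    _ ≤ 1 * (n * (1/n)) := by gcongr
    _ = 1 := by field_simp

theorem eventually_max_one_div_sub_eq_zero {x : ℝ} (hx : 0 < x) :
    ∀ᶠ n : ℕ in atTop, max (1/(n : ℝ) - x) 0 = 0 := by
  filter_upwards [(tendsto_one_div_atTop_nhds_zero_nat (𝕜 := ℝ)).eventually_lt_const hx] with n hn
  exact max_eq_right (by linarith)

theorem stmt_2 (h : ℝ) (hh1 : 1/2 < h) (hh2 : h < 1) :
    ∃ phi' phi'' : ℕ → ℝ → ℝ,
      (∀ n : ℕ, 1 ≤ n →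
        -- φₙ is twice continuously differentiable on [0,∞), with first and
        -- second derivatives `phi' n` and `phi'' n`
        (∀ x ∈ Set.Ici (0:ℝ), HasDerivWithinAt (phiAux h n) (phi' n x) (Set.Ici 0) x) ∧
        (∀ x ∈ Set.Ici (0:ℝ), HasDerivWithinAt (phi' n) (phi'' n x) (Set.Ici 0) x) ∧
        ContinuousOn (phi'' n) (Set.Ici 0) ∧
        -- the pointwise bounds
        (∀ x : ℝ, 0 ≤ x →
          0 ≤ phiAux h n x ∧ phiAux h n x ≤ 1/(h+1) ∧
          |phi' n x| ≤ 1 ∧ |phi'' n x * x ^ (2*h)| ≤ 2*h+1)) ∧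
      -- the pointwise limits as n → ∞
      (∀ x : ℝ, 0 ≤ x →
        Tendsto (fun n : ℕ => phiAux h n x) atTop (𝓝 0) ∧
        Tendsto (fun n : ℕ => phi' n x) atTop (𝓝 (if x = 0 then -1 else 0)) ∧
        Tendsto (fun n : ℕ => phi'' n x * x ^ (2*h)) atTop (𝓝 0)) := by
  refine ⟨fun n x => -((n : ℝ) ^ (2*h+1) * max (1/(n : ℝ) - x) 0 ^ (2*h+1)),
    fun n x => (2*h+1) * ((n : ℝ) ^ (2*h+1) * max (1/(n : ℝ) - x) 0 ^ (2*h)), ?_, ?_⟩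
  · intro n hn
    have hn1 : (1 : ℝ) ≤ n := by exact_mod_cast hn
    refine ⟨fun x _ => ?_, fun x _ => ?_, ?_, fun x hx => ⟨?_, ?_, ?_, ?_⟩⟩
    · rw [funext (phiAux_eq_max (h := h) (by linarith) n)]
      have hd := ((hasDerivAt_max_sub_zero_rpow (p := 2*(h+1)) (by linarith) (1/(n : ℝ)) x).const_mul
        ((n : ℝ) ^ (2*h+1) / (2*(h+1)))).add_const (1 / (2*(h+1)*n))
      refine (hd.congr_deriv ?_).hasDerivWithinAt
      have hh' : h + 1 ≠ 0 := by linarith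
      rw [show 2*(h+1) - 1 = 2*h+1 by ring]
      field_simp
    · have hd := ((hasDerivAt_max_sub_zero_rpow (p := 2*h+1) (by linarith) (1/(n : ℝ)) x).const_mul
        ((n : ℝ) ^ (2*h+1))).neg
      refine (hd.congr_deriv ?_).hasDerivWithinAt
      rw [add_sub_cancel_right]
      ring
    · refine Continuous.continuousOn (continuous_const.mul (continuous_const.mul ?_))
      exact Continuous.rpow_const (by fun_prop) fun _ => Or.inr (by linarith)
    · exact phiAux_nonneg (by linarith) n x
    · have hh' : 0 < h + 1 := by linarith
      refine (phiAux_le (by linarith) hn hx).trans (mul_le_of_le_one_right (by positivity) ?_)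
      exact (div_le_one (by linarith)).2 hn1
    · have hm : 0 ≤ max (1/(n : ℝ) - x) 0 := le_max_right _ _
      rw [abs_neg, abs_of_nonneg (by positivity)]
      exact rpow_mul_max_rpow_le_one hx (by linarith)
    · have hm : 0 ≤ max (1/(n : ℝ) - x) 0 := le_max_right _ _
      have hh' : 0 < 2*h+1 := by linarith
      rw [abs_of_nonneg (by positivity), mul_assoc]
      exact mul_le_of_le_one_right hh'.le
        (rpow_mul_max_rpow_mul_rpow_le_one hh1.le hn hx)
  · intro x hx
    refine ⟨?_, ?_, ?_⟩
    · have hlim : Tendsto (fun n : ℕ => 1 / (h+1) * (1 / (n : ℝ))) atTop (𝓝 0) := by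
        simpa using (tendsto_one_div_atTop_nhds_zero_nat (𝕜 := ℝ)).const_mul (1 / (h+1))
      refine squeeze_zero' (.of_forall fun n => phiAux_nonneg (by linarith) n x) ?_ hlim
      filter_upwards [eventually_ge_atTop 1] with n hn
      exact phiAux_le (by linarith) hn hx
    · refine tendsto_const_nhds.congr' ?_
      rcases hx.eq_or_lt with rfl | hx
      · filter_upwards [eventually_ge_atTop 1] with n hn
        have hn0 : (0 : ℝ) < n := by exact_mod_cast hn
        rw [if_pos rfl, sub_zero, max_eq_left (by positivity),
          ← mul_rpow hn0.le (by positivity), mul_one_div_cancel hn0.ne', one_rpow]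
      · filter_upwards [eventually_max_one_div_sub_eq_zero hx] with n hn
        rw [if_neg hx.ne', hn, zero_rpow (by linarith), mul_zero, neg_zero]
    · refine tendsto_const_nhds.congr' ?_
      rcases hx.eq_or_lt with rfl | hx
      · filter_upwards with n
        rw [zero_rpow (show 2*h ≠ 0 by linarith), mul_zero]
      · filter_upwards [eventually_max_one_div_sub_eq_zero hx] with n hn
        rw [hn, zero_rpow (by linarith), mul_zero, mul_zero, zero_mul]
end

section
/- Let h, α, δ be real constants with 1/2 < h < 1, α > 0 and δ > 0, and for x > 0 set η̃(x) = x^{-2h}·exp( (2α/(1-2h))·x^{1-2h} - (δ/(1-h))·x^{2-2h} ). Then there exists a unique x₀ > 0 satisfying 2δ·x₀ + h·x₀^{2h-1} = 2α, and the function x ↦ x^h·η̃(x) is strictly increasing on (0, x₀] and strictly decreasing on [x₀, ∞). -/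
open Real Set

/-- The (unnormalized) invariant density of the generalized CIR model. -/
noncomputable def etaT (h α δ x : ℝ) : ℝ :=
  x ^ (-(2*h)) * Real.exp ((2*α/(1-2*h)) * x ^ (1-2*h) - (δ/(1-h)) * x ^ (2-2*h))

lemma strictMonoOn_drift {h δ : ℝ} (hh : 1/2 < h) (hδ : 0 < δ) :
    StrictMonoOn (fun x : ℝ => 2*δ*x + h * x ^ (2*h-1)) (Ici 0) := by
  intro x hx y _ hxy
  have := Real.rpow_lt_rpow hx hxy (by linarith : 0 < 2*h-1)
  dsimp only
  gcongr

lemma continuous_drift {h δ : ℝ} (hh : 1/2 < h) :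
    Continuous (fun x : ℝ => 2*δ*x + h * x ^ (2*h-1)) := by
  have := Real.continuous_rpow_const (by linarith : 0 ≤ 2*h-1)
  fun_prop

lemma exists_drift_eq {h α δ : ℝ} (hh : 1/2 < h) (hα : 0 < α) (hδ : 0 < δ) :
    ∃ x : ℝ, 0 < x ∧ 2*δ*x + h * x ^ (2*h-1) = 2*α := by
  have hb : 0 < α/δ := by positivity
  have h0 : 2*δ*0 + h * (0:ℝ) ^ (2*h-1) = 0 := by
    rw [Real.zero_rpow (by linarith)]; ring
  have hle : 2*α ≤ 2*δ*(α/δ) + h * (α/δ) ^ (2*h-1) := by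
    have h1 : 2*δ*(α/δ) = 2*α := by field_simp
    have h2 : 0 ≤ h * (α/δ) ^ (2*h-1) := by positivity
    linarith
  obtain ⟨x, hx, hxe⟩ := intermediate_value_Icc hb.le
    (continuous_drift (δ := δ) hh).continuousOn ⟨by linarith, hle⟩
  refine ⟨x, hx.1.lt_of_ne ?_, hxe⟩
  rintro rfl
  dsimp only at hxe
  linarith

lemma rpow_mul_etaT_eq_exp {h α δ x : ℝ} (hx : 0 < x) :
    x ^ h * etaT h α δ x =
      exp (-h * log x + (2*α/(1-2*h)) * x ^ (1-2*h) - (δ/(1-h)) * x ^ (2-2*h)) := by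
  rw [etaT, ← mul_assoc, ← Real.rpow_add hx, Real.rpow_def_of_pos hx (h + _), ← Real.exp_add]
  congr 1
  ring

lemma hasDerivAt_log_rpow_mul_etaT {h α δ x : ℝ} (hh1 : 1/2 < h) (hh2 : h < 1) (hx : 0 < x) :
    HasDerivAt (fun x : ℝ =>
        -h * log x + (2*α/(1-2*h)) * x ^ (1-2*h) - (δ/(1-h)) * x ^ (2-2*h))
      (x ^ (-(2*h)) * (2*α - (2*δ*x + h * x ^ (2*h-1)))) x := by
  have h1 : 1 - 2*h ≠ 0 := by linarith
  have h2 : 1 - h ≠ 0 := by linarith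
  have hd := (((Real.hasDerivAt_log hx.ne').const_mul (-h)).add
    ((Real.hasDerivAt_rpow_const (p := 1-2*h) (Or.inl hx.ne')).const_mul (2*α/(1-2*h)))).sub
    ((Real.hasDerivAt_rpow_const (p := 2-2*h) (Or.inl hx.ne')).const_mul (δ/(1-h)))
  refine hd.congr_deriv ?_
  have e1 : x ^ (1-2*h-1) = x ^ (-(2*h)) := by congr 1; ring
  have e2 : x ^ (2-2*h-1) = x ^ (-(2*h)) * x := by
    rw [← Real.rpow_add_one hx.ne']; congr 1; ring
  have e3 : x⁻¹ = x ^ (-(2*h)) * x ^ (2*h-1) := by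
    rw [← Real.rpow_add hx, ← Real.rpow_neg_one]; congr 1; ring
  have c1 : 2*α/(1-2*h) * (1-2*h) = 2*α := div_mul_cancel₀ _ h1
  have c2 : δ/(1-h) * (1-h) = δ := div_mul_cancel₀ _ h2
  rw [e1, e2, e3]
  linear_combination x ^ (-(2*h)) * c1 - 2 * x ^ (-(2*h)) * x * c2

theorem stmt_5 (h α δ : ℝ) (hh1 : 1/2 < h) (hh2 : h < 1) (hα : 0 < α) (hδ : 0 < δ) :
    ∃ x₀ : ℝ, 0 < x₀ ∧ 2*δ*x₀ + h * x₀ ^ (2*h-1) = 2*α ∧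
      (∀ x : ℝ, 0 < x → 2*δ*x + h * x ^ (2*h-1) = 2*α → x = x₀) ∧
      StrictMonoOn (fun x : ℝ => x ^ h * etaT h α δ x) (Set.Ioc 0 x₀) ∧
      StrictAntiOn (fun x : ℝ => x ^ h * etaT h α δ x) (Set.Ici x₀) := by
  obtain ⟨x₀, hx₀, he⟩ := exists_drift_eq hh1 hα hδ
  have hmono := strictMonoOn_drift hh1 hδ
  have hcont : ContinuousOn (fun x : ℝ =>
      -h * log x + (2*α/(1-2*h)) * x ^ (1-2*h) - (δ/(1-h)) * x ^ (2-2*h)) (Ioi 0) :=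
    fun x hx => (hasDerivAt_log_rpow_mul_etaT hh1 hh2 hx).continuousAt.continuousWithinAt
  refine ⟨x₀, hx₀, he, fun x hx hxe => hmono.injOn hx.le hx₀.le (hxe.trans he.symm), ?_, ?_⟩
  · have hG := strictMonoOn_of_deriv_pos (convex_Ioc 0 x₀) (hcont.mono fun x hx => hx.1)
      fun x hx => by
        rw [interior_Ioc] at hx
        rw [(hasDerivAt_log_rpow_mul_etaT hh1 hh2 hx.1).deriv]
        have := hmono hx.1.le hx₀.le hx.2
        exact mul_pos (Real.rpow_pos_of_pos hx.1 _) (sub_pos.2 (this.trans_eq he))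
    exact (Real.exp_strictMono.comp_strictMonoOn hG).congr
      fun x hx => (rpow_mul_etaT_eq_exp hx.1).symm
  · have hG := strictAntiOn_of_deriv_neg (convex_Ici x₀)
      (hcont.mono fun x hx => hx₀.trans_le hx)
      fun x hx => by
        rw [interior_Ici] at hx
        have hx0 : 0 < x := hx₀.trans hx
        rw [(hasDerivAt_log_rpow_mul_etaT hh1 hh2 hx0).deriv]
        have := hmono hx₀.le hx0.le hx
        exact mul_neg_of_pos_of_neg (Real.rpow_pos_of_pos hx0 _)
          (sub_neg.2 (he.symm.trans_lt this))
    exact (Real.exp_strictMono.comp_strictAntiOn hG).congr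
      fun x hx => (rpow_mul_etaT_eq_exp (hx₀.trans_le hx)).symm
end

section
/- Let h, α, δ be real constants with 1/2 < h < 1, α > 0 and δ > 0, and for x > 0 set η̃(x) = x^{-2h}·exp( (2α/(1-2h))·x^{1-2h} - (δ/(1-h))·x^{2-2h} ). Then lim_{t → 0⁺} [ ∫₀^t η̃(s) ds ] / [ (1/(2α))·exp( (2α/(1-2h))·t^{1-2h} ) ] = 1. -/
open Real Set MeasureTheory Filter Topology

/-- A function on `(a, ∞)` with a nonnegative derivative and a limit at `a⁺` has an integrable
derivative near `a`, whose integral is the increment of the function. -/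
theorem integrableOn_and_setIntegral_Ioc_of_tendsto_nhdsGT {f f' : ℝ → ℝ} {a b l : ℝ} (hab : a < b)
    (hderiv : ∀ x ∈ Ioi a, HasDerivAt f (f' x) x) (hpos : ∀ x ∈ Ioi a, 0 ≤ f' x)
    (hlim : Tendsto f (𝓝[>] a) (𝓝 l)) :
    IntegrableOn f' (Ioc a b) ∧ ∫ x in Ioc a b, f' x = f b - l := by
  have hd : ∀ x ∈ Ioi a, HasDerivAt (Function.update f a l) (f' x) x := fun x hx =>
    (hderiv x hx).congr_of_eventuallyEq <| by
      filter_upwards [Ioi_mem_nhds hx] with y hy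
      exact Function.update_of_ne (ne_of_gt hy) _ _
  have hc : ContinuousOn (Function.update f a l) (Icc a b) := by
    intro x hx
    rcases hx.1.eq_or_lt with rfl | hx'
    · rw [continuousWithinAt_update_same]
      exact hlim.mono_left (nhdsWithin_mono _ fun y hy => lt_of_le_of_ne hy.1.1 (Ne.symm hy.2))
    · exact (hd x hx').continuousAt.continuousWithinAt
  have hi : IntegrableOn f' (Ioc a b) :=
    intervalIntegral.integrableOn_deriv_of_nonneg hc (fun x hx => hd x hx.1)
      (fun x hx => hpos x hx.1)
  refine ⟨hi, ?_⟩
  rw [← intervalIntegral.integral_of_le hab.le,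
    intervalIntegral.integral_eq_sub_of_hasDerivAt_of_le hab.le hc (fun x hx => hd x hx.1)
      ((intervalIntegrable_iff_integrableOn_Ioc_of_le hab.le).2 hi),
    Function.update_self, Function.update_of_ne hab.ne']

theorem hasDerivAt_exp_mul_rpow {h α x : ℝ} (hh : 1 / 2 < h) (hα : 0 < α) (hx : 0 < x) :
    HasDerivAt (fun s : ℝ => (1/(2*α)) * Real.exp ((2*α/(1-2*h)) * s ^ (1-2*h)))
      (x ^ (-(2*h)) * Real.exp ((2*α/(1-2*h)) * x ^ (1-2*h))) x := by
  have h0 : 1 - 2*h ≠ 0 := by linarith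
  have hd := (((Real.hasDerivAt_rpow_const (p := 1-2*h) (Or.inl hx.ne')).const_mul
    (2*α/(1-2*h))).exp).const_mul (1/(2*α))
  refine hd.congr_deriv ?_
  rw [show 1 - 2*h - 1 = -(2*h) by ring]
  field_simp

theorem tendsto_exp_mul_rpow_nhdsGT_zero {h α : ℝ} (hh : 1 / 2 < h) (hα : 0 < α) :
    Tendsto (fun s : ℝ => (1/(2*α)) * Real.exp ((2*α/(1-2*h)) * s ^ (1-2*h)))
      (𝓝[>] 0) (𝓝 0) := by
  have hc : 2*α/(1-2*h) < 0 := div_neg_of_pos_of_neg (by linarith) (by linarith)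
  have hr : Tendsto (fun s : ℝ => s ^ (1-2*h)) (𝓝[>] 0) atTop :=
    tendsto_rpow_neg_nhdsGT_zero (by linarith)
  simpa using (Real.tendsto_exp_atBot.comp (hr.const_mul_atTop_of_neg hc)).const_mul (1/(2*α))

theorem stmt_6 (h α δ : ℝ) (hh1 : 1/2 < h) (hh2 : h < 1) (hα : 0 < α) (hδ : 0 < δ) :
    Tendsto (fun t : ℝ =>
        (∫ s in Set.Ioc 0 t, etaT h α δ s) /
          ((1/(2*α)) * Real.exp ((2*α/(1-2*h)) * t ^ (1-2*h))))
      (𝓝[>] 0) (𝓝 1) := by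
  have hd : 0 < δ/(1-h) := div_pos hδ (by linarith)
  have hp : 0 < 2 - 2*h := by linarith
  set g : ℝ → ℝ := fun x => x ^ (-(2*h)) * Real.exp ((2*α/(1-2*h)) * x ^ (1-2*h)) with hg
  have hg0 : ∀ x ∈ Ioi (0:ℝ), 0 ≤ g x := fun x hx =>
    mul_nonneg (rpow_nonneg (le_of_lt hx) _) (exp_pos _).le
  have heta : ∀ x, etaT h α δ x = g x * Real.exp (-(δ/(1-h) * x ^ (2-2*h))) := fun x => by
    rw [etaT, hg, mul_assoc, ← Real.exp_add, sub_eq_add_neg]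
  have hlow : Tendsto (fun t : ℝ => Real.exp (-(δ/(1-h) * t ^ (2-2*h)))) (𝓝[>] 0) (𝓝 1) := by
    have hcont : Continuous fun t : ℝ => Real.exp (-(δ/(1-h) * t ^ (2-2*h))) :=
      (continuous_const.mul (Real.continuous_rpow_const hp.le)).neg.rexp
    simpa [Real.zero_rpow hp.ne'] using (hcont.tendsto 0).mono_left nhdsWithin_le_nhds
  have hbounds : ∀ t ∈ Ioi (0:ℝ),
      Real.exp (-(δ/(1-h) * t ^ (2-2*h))) *
          ((1/(2*α)) * Real.exp ((2*α/(1-2*h)) * t ^ (1-2*h))) ≤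
        ∫ s in Set.Ioc 0 t, etaT h α δ s ∧
      ∫ s in Set.Ioc 0 t, etaT h α δ s ≤
        (1/(2*α)) * Real.exp ((2*α/(1-2*h)) * t ^ (1-2*h)) := by
    intro t ht
    obtain ⟨hgi, hgint⟩ := integrableOn_and_setIntegral_Ioc_of_tendsto_nhdsGT (b := t) ht
      (fun x hx => hasDerivAt_exp_mul_rpow hh1 hα hx) hg0 (tendsto_exp_mul_rpow_nhdsGT_zero hh1 hα)
    rw [sub_zero] at hgint
    have hle : ∀ x ∈ Ioc 0 t, etaT h α δ x ≤ g x := fun x hx => by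
      rw [heta]
      refine mul_le_of_le_one_right (hg0 x hx.1) (Real.exp_le_one_iff.2 ?_)
      have := mul_nonneg hd.le (rpow_nonneg hx.1.le (2-2*h))
      linarith
    have hge : ∀ x ∈ Ioc 0 t, Real.exp (-(δ/(1-h) * t ^ (2-2*h))) * g x ≤ etaT h α δ x :=
      fun x hx => by
        rw [heta, mul_comm]
        refine mul_le_mul_of_nonneg_left (Real.exp_le_exp.2 (neg_le_neg ?_)) (hg0 x hx.1)
        exact mul_le_mul_of_nonneg_left (rpow_le_rpow hx.1.le hx.2 hp.le) hd.le
    have hei : IntegrableOn (etaT h α δ) (Ioc 0 t) := by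
      refine hgi.mono' ?_ ((ae_restrict_iff' measurableSet_Ioc).2 (ae_of_all _ fun x hx => ?_))
      · exact Measurable.aestronglyMeasurable (by unfold etaT; fun_prop)
      · rw [Real.norm_of_nonneg]
        · exact hle x hx
        · rw [heta]
          exact mul_nonneg (hg0 x hx.1) (exp_pos _).le
    rw [← hgint]
    refine ⟨?_, setIntegral_mono_on hei hgi measurableSet_Ioc hle⟩
    rw [← integral_const_mul]
    exact setIntegral_mono_on (hgi.const_mul _) hei measurableSet_Ioc hge
  have hpos : ∀ t : ℝ, 0 < (1/(2*α)) * Real.exp ((2*α/(1-2*h)) * t ^ (1-2*h)) := fun t => by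
    positivity
  refine tendsto_of_tendsto_of_tendsto_of_le_of_le' hlow tendsto_const_nhds ?_ ?_
  · filter_upwards [self_mem_nhdsWithin] with t ht
    exact (le_div_iff₀ (hpos t)).2 (hbounds t ht).1
  · filter_upwards [self_mem_nhdsWithin] with t ht
    exact (div_le_one (hpos t)).2 (hbounds t ht).2
end

section
/- Let h, α, δ be real constants with 1/2 < h < 1, α > 0 and δ > 0, and for x > 0 set η̃(x) = x^{-2h}·exp( (2α/(1-2h))·x^{1-2h} - (δ/(1-h))·x^{2-2h} ). Then lim_{t → ∞} [ ∫_t^∞ η̃(s) ds ] / [ (1/(2δ))·t^{-1}·exp( -(δ/(1-h))·t^{2-2h} ) ] = 1. -/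
open Real Set MeasureTheory Filter Topology

/-- The exponent in `etaT` is nonpositive, so the exponential factor is at most one. -/
lemma etaT_le_rpow {h α δ x : ℝ} (hh1 : 1/2 < h) (hh2 : h < 1) (hα : 0 < α) (hδ : 0 < δ)
    (hx : 0 < x) : etaT h α δ x ≤ x ^ (-(2*h)) := by
  have h1 : 2*α/(1-2*h) ≤ 0 := div_nonpos_of_nonneg_of_nonpos (by linarith) (by linarith)
  have h2 : 0 ≤ δ/(1-h) := div_nonneg hδ.le (by linarith)
  have h3 : (2*α/(1-2*h)) * x ^ (1-2*h) ≤ 0 :=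
    mul_nonpos_of_nonpos_of_nonneg h1 (rpow_nonneg hx.le _)
  have h4 : 0 ≤ (δ/(1-h)) * x ^ (2-2*h) := mul_nonneg h2 (rpow_nonneg hx.le _)
  exact mul_le_of_le_one_right (rpow_nonneg hx.le _) (exp_le_one_iff.2 (by linarith))

lemma etaT_nonneg {h α δ x : ℝ} (hx : 0 < x) : 0 ≤ etaT h α δ x :=
  mul_nonneg (rpow_nonneg hx.le _) (exp_pos _).le

lemma continuousOn_etaT (h α δ : ℝ) : ContinuousOn (etaT h α δ) (Ioi 0) := by
  have hr (p : ℝ) : ContinuousOn (fun x : ℝ => x ^ p) (Ioi 0) := fun x hx =>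
    (continuousAt_rpow_const x p (Or.inl (ne_of_gt hx))).continuousWithinAt
  unfold etaT
  exact (hr _).mul (continuous_exp.comp_continuousOn
    ((continuousOn_const.mul (hr _)).sub (continuousOn_const.mul (hr _))))

lemma integrableOn_Ioi_etaT {h α δ t : ℝ} (hh1 : 1/2 < h) (hh2 : h < 1) (hα : 0 < α)
    (hδ : 0 < δ) (ht : 0 < t) : IntegrableOn (etaT h α δ) (Ioi t) := by
  refine Integrable.mono' (integrableOn_Ioi_rpow_of_lt (a := -(2*h)) (by linarith) ht)
    (((continuousOn_etaT h α δ).mono (Ioi_subset_Ioi ht.le)).aestronglyMeasurable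
      measurableSet_Ioi) ?_
  filter_upwards [ae_restrict_mem measurableSet_Ioi] with x hx
  have hx0 : 0 < x := ht.trans hx
  rw [norm_of_nonneg (etaT_nonneg hx0)]
  exact etaT_le_rpow hh1 hh2 hα hδ hx0

lemma integral_Ioi_etaT_eq {h α δ t : ℝ} (hh1 : 1/2 < h) (hh2 : h < 1) (hα : 0 < α)
    (hδ : 0 < δ) (ht : 0 < t) :
    ∫ s in Ioi t, etaT h α δ s = (∫ s in Ioi 1, etaT h α δ s) - ∫ s in (1:ℝ)..t, etaT h α δ s := by
  rw [eq_sub_iff_add_eq, add_comm]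
  exact intervalIntegral.integral_interval_add_Ioi
    (integrableOn_Ioi_etaT hh1 hh2 hα hδ one_pos) (integrableOn_Ioi_etaT hh1 hh2 hα hδ ht)

lemma hasDerivAt_integral_Ioi_etaT {h α δ t : ℝ} (hh1 : 1/2 < h) (hh2 : h < 1) (hα : 0 < α)
    (hδ : 0 < δ) (ht : 0 < t) :
    HasDerivAt (fun t => ∫ s in Ioi t, etaT h α δ s) (-etaT h α δ t) t := by
  have hsub : uIcc 1 t ⊆ Ioi (0:ℝ) := fun x hx => (lt_min one_pos ht).trans_le hx.1
  have hc := continuousOn_etaT h α δ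
  have hd := intervalIntegral.integral_hasDerivAt_right
    (hc.mono hsub).intervalIntegrable
    (hc.stronglyMeasurableAtFilter isOpen_Ioi t ht) (hc.continuousAt (Ioi_mem_nhds ht))
  refine (hd.const_sub (∫ s in Ioi 1, etaT h α δ s)).congr_of_eventuallyEq ?_
  filter_upwards [Ioi_mem_nhds ht] with x hx
  exact integral_Ioi_etaT_eq hh1 hh2 hα hδ hx

lemma hasDerivAt_inv_mul_exp_rpow {h δ t : ℝ} (hh2 : h < 1) (hδ : 0 < δ) (ht : 0 < t) :
    HasDerivAt (fun t => (1/(2*δ)) * t⁻¹ * exp (-(δ/(1-h)) * t ^ (2-2*h)))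
      (-(t ^ (-(2*h)) * (1 + 1/(2*δ) * t ^ (-(2-2*h))) * exp (-(δ/(1-h)) * t ^ (2-2*h)))) t := by
  have hd := ((hasDerivAt_inv ht.ne').const_mul (1/(2*δ))).mul
    (((hasDerivAt_rpow_const (p := 2-2*h) (Or.inl ht.ne')).const_mul (-(δ/(1-h)))).exp)
  convert! hd using 1
  have e1 : t ^ (2-2*h-1) = t ^ (-(2*h)) * t := by
    rw [← rpow_add_one ht.ne']; ring_nf
  have e2 : (t^2)⁻¹ = t ^ (-(2*h)) * t ^ (-(2-2*h)) := by
    rw [← rpow_add ht, ← rpow_natCast, ← rpow_neg ht.le]; push_cast; ring_nf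
  have : 1 - h ≠ 0 := by linarith
  rw [e1, e2]
  field_simp
  ring

theorem stmt_7 (h α δ : ℝ) (hh1 : 1/2 < h) (hh2 : h < 1) (hα : 0 < α) (hδ : 0 < δ) :
    Tendsto (fun t : ℝ =>
        (∫ s in Set.Ioi t, etaT h α δ s) /
          ((1/(2*δ)) * t⁻¹ * Real.exp (-(δ/(1-h)) * t ^ (2-2*h))))
      atTop (𝓝 1) := by
  refine HasDerivAt.lhopital_zero_atTop
    ((eventually_gt_atTop 0).mono fun t ht => hasDerivAt_integral_Ioi_etaT hh1 hh2 hα hδ ht)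
    ((eventually_gt_atTop 0).mono fun t ht => hasDerivAt_inv_mul_exp_rpow hh2 hδ ht)
    ?_ (tendsto_integral_Ioi_zero tendsto_id) ?_ ?_
  · filter_upwards [eventually_gt_atTop 0] with t ht
    exact neg_ne_zero.2 (by positivity)
  · have hc : 0 < δ/(1-h) := div_pos hδ (by linarith)
    have hexp : Tendsto (fun t : ℝ => exp (-(δ/(1-h)) * t ^ (2-2*h))) atTop (𝓝 0) :=
      tendsto_exp_atBot.comp ((tendsto_rpow_atTop (by linarith)).const_mul_atTop_of_neg
        (neg_lt_zero.2 hc))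
    simpa using (tendsto_inv_atTop_zero.const_mul (1/(2*δ))).mul hexp
  · have hnum : Tendsto (fun t : ℝ => exp ((2*α/(1-2*h)) * t ^ (1-2*h))) atTop (𝓝 1) := by
      have := (tendsto_rpow_neg_atTop (y := 2*h-1) (by linarith)).const_mul (2*α/(1-2*h))
      simpa [neg_sub] using this.rexp
    have hden : Tendsto (fun t : ℝ => 1 + 1/(2*δ) * t ^ (-(2-2*h))) atTop (𝓝 1) := by
      simpa using ((tendsto_rpow_neg_atTop (y := 2-2*h) (by linarith)).const_mul
        (1/(2*δ))).const_add 1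
    have hlim := hnum.div hden one_ne_zero
    rw [div_one] at hlim
    refine hlim.congr' ?_
    filter_upwards [eventually_gt_atTop 0] with t ht
    have hp : 0 < t ^ (-(2*h)) := rpow_pos_of_pos ht _
    have hq : 0 < 1 + 1/(2*δ) * t ^ (-(2-2*h)) := by positivity
    have he : etaT h α δ t = t ^ (-(2*h)) * exp ((2*α/(1-2*h)) * t ^ (1-2*h))
        * exp (-(δ/(1-h)) * t ^ (2-2*h)) := by
      rw [etaT, mul_assoc, ← exp_add, neg_mul, sub_eq_add_neg]
    rw [he, neg_div_neg_eq, mul_div_mul_right _ _ (exp_pos _).ne', mul_div_mul_left _ _ hp.ne']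
    rfl
end

section
/- Let h, α, δ be real constants with 1/2 < h < 1, α > 0 and δ > 0, for x > 0 set η̃(x) = x^{-2h}·exp( (2α/(1-2h))·x^{1-2h} - (δ/(1-h))·x^{2-2h} ), let Z = ∫₀^∞ η̃(x) dx, and let μ be the probability measure on (0,∞) with density η = η̃/Z with respect to Lebesgue measure. Then there exists r₀ > 0 such that for all x₁, x₂ > 0 with μ((0,x₁)) = μ((x₂,∞)) ≤ r₀, one has x₁^h·η(x₁) > x₂^h·η(x₂). -/
open Real Set MeasureTheory Filter Topology

/-- The normalizing constant of the invariant density. -/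
noncomputable def Zcst (h α δ : ℝ) : ℝ := ∫ x in Set.Ioi (0:ℝ), etaT h α δ x

/-- The normalized invariant density `η = η̃ / Z`. -/
noncomputable def etaN (h α δ x : ℝ) : ℝ := etaT h α δ x / Zcst h α δ

/-- The exponential factor of `etaT`. -/
noncomputable def etaExp (h α δ x : ℝ) : ℝ :=
  Real.exp ((2*α/(1-2*h)) * x ^ (1-2*h) - (δ/(1-h)) * x ^ (2-2*h))

lemma etaT_eq (h α δ x : ℝ) : etaT h α δ x = x ^ (-(2*h)) * etaExp h α δ x := rfl

lemma etaExp_pos (h α δ x : ℝ) : 0 < etaExp h α δ x := Real.exp_pos _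

lemma etaT_pos (h α δ : ℝ) {x : ℝ} (hx : 0 < x) : 0 < etaT h α δ x :=
  mul_pos (rpow_pos_of_pos hx _) (Real.exp_pos _)

lemma hasDerivAt_etaExp {h α δ x : ℝ} (hh1 : 1/2 < h) (hh2 : h < 1) (hx : 0 < x) :
    HasDerivAt (etaExp h α δ) (etaT h α δ x * (2*α - 2*δ*x)) x := by
  have h1 : HasDerivAt (fun y : ℝ => y ^ (1-2*h)) ((1-2*h) * x ^ (1-2*h-1)) x :=
    hasDerivAt_rpow_const (Or.inl hx.ne')
  have h2 : HasDerivAt (fun y : ℝ => y ^ (2-2*h)) ((2-2*h) * x ^ (2-2*h-1)) x :=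
    hasDerivAt_rpow_const (Or.inl hx.ne')
  have h3 := ((h1.const_mul (2*α/(1-2*h))).sub (h2.const_mul (δ/(1-h)))).exp
  refine h3.congr_deriv ?_
  have e1 : x ^ (1-2*h-1) = x ^ (-(2*h)) := by congr 1; ring
  have e2 : x ^ (2-2*h-1) = x ^ (-(2*h)) * x := by
    rw [show 2-2*h-1 = -(2*h) + 1 by ring, rpow_add hx, rpow_one]
  have n1 : 1 - 2*h ≠ 0 := by linarith
  have n2 : 1 - h ≠ 0 := by linarith
  rw [e1, e2, etaT_eq, etaExp]
  simp only [Pi.sub_apply]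
  field_simp

lemma integrableOn_rpow_mul_exp_neg {c p : ℝ} (hc : 0 < c) (hp : p ≠ 0) :
    IntegrableOn (fun x : ℝ => x ^ (p - 1) * Real.exp (-c * x ^ p)) (Ioi 0) :=
  (integrableOn_Ioi_comp_rpow_iff' (fun t : ℝ => Real.exp (-c * t)) hp).2
    (exp_neg_integrableOn_Ioi 0 hc)

lemma integrableOn_etaT {h α δ : ℝ} (hh1 : 1/2 < h) (hh2 : h < 1) (hα : 0 < α) (hδ : 0 < δ) :
    IntegrableOn (etaT h α δ) (Ioi 0) := by
  have hc : 0 < 2*α/(2*h-1) := div_pos (by linarith) (by linarith)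
  have hp : 1 - 2*h ≠ 0 := by linarith
  refine (integrableOn_rpow_mul_exp_neg hc hp).mono'
    ((continuousOn_etaT h α δ).aestronglyMeasurable measurableSet_Ioi) ?_
  refine (ae_restrict_iff' measurableSet_Ioi).2 (ae_of_all _ fun x hx => ?_)
  have hx : 0 < x := hx
  rw [Real.norm_of_nonneg (etaT_pos h α δ hx).le, etaT_eq, etaExp,
    show 1-2*h-1 = -(2*h) by ring]
  gcongr
  have e : 2*α/(1-2*h) = -(2*α/(2*h-1)) := by
    rw [← div_neg]; congr 1; ring
  have : 0 ≤ δ/(1-h) * x ^ (2-2*h) :=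
    mul_nonneg (div_pos hδ (by linarith)).le (rpow_nonneg hx.le _)
  rw [e]
  linarith

lemma integrableOn_etaT_mul_id {h α δ : ℝ} (hh1 : 1/2 < h) (hh2 : h < 1) (hα : 0 < α)
    (hδ : 0 < δ) : IntegrableOn (fun x => etaT h α δ x * x) (Ioi 0) := by
  have hc : 0 < δ/(1-h) := div_pos (by linarith) (by linarith)
  have hp : 2 - 2*h ≠ 0 := by linarith
  refine (integrableOn_rpow_mul_exp_neg hc hp).mono'
    (((continuousOn_etaT h α δ).mul continuousOn_id).aestronglyMeasurable measurableSet_Ioi) ?_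
  refine (ae_restrict_iff' measurableSet_Ioi).2 (ae_of_all _ fun x hx => ?_)
  have hx : 0 < x := hx
  rw [Real.norm_of_nonneg (mul_pos (etaT_pos h α δ hx) hx).le, etaT_eq, etaExp,
    show 2-2*h-1 = -(2*h) + 1 by ring, rpow_add hx, rpow_one, mul_right_comm]
  gcongr
  have : 2*α/(1-2*h) * x ^ (1-2*h) ≤ 0 :=
    mul_nonpos_of_nonpos_of_nonneg
      (div_nonpos_of_nonneg_of_nonpos (by linarith) (by linarith)) (rpow_nonneg hx.le _)
  linarith

lemma integrableOn_deriv_etaExp {h α δ : ℝ} (hh1 : 1/2 < h) (hh2 : h < 1) (hα : 0 < α)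
    (hδ : 0 < δ) : IntegrableOn (fun x => etaT h α δ x * (2*α - 2*δ*x)) (Ioi 0) := by
  have h1 := (integrableOn_etaT hh1 hh2 hα hδ).const_mul (2*α)
  have h2 := (integrableOn_etaT_mul_id hh1 hh2 hα hδ).const_mul (2*δ)
  refine (h1.sub h2).congr (ae_of_all _ fun x => ?_)
  simp only [Pi.sub_apply]
  ring

lemma tendsto_etaExp_nhdsGT_zero {h α δ : ℝ} (hh1 : 1/2 < h) (hh2 : h < 1) (hα : 0 < α) :
    Tendsto (etaExp h α δ) (𝓝[>] 0) (𝓝 0) := by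
  have h1 : Tendsto (fun x : ℝ => (2*α/(1-2*h)) * x ^ (1-2*h)) (𝓝[>] 0) atBot :=
    (tendsto_rpow_neg_nhdsGT_zero (by linarith)).const_mul_atTop_of_neg
      (div_neg_of_pos_of_neg (by linarith) (by linarith))
  have h2 : Tendsto (fun x : ℝ => -((δ/(1-h)) * x ^ (2-2*h))) (𝓝[>] 0)
      (𝓝 (-((δ/(1-h)) * 0 ^ (2-2*h)))) :=
    (((continuousAt_rpow_const 0 (2-2*h) (Or.inr (by linarith))).tendsto.mono_left
      nhdsWithin_le_nhds).const_mul _).neg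
  exact tendsto_exp_atBot.comp ((h1.atBot_add h2).congr fun x => (sub_eq_add_neg _ _).symm)

lemma etaExp_le {h α δ x : ℝ} (hh1 : 1/2 < h) (hα : 0 < α) (hx : 0 < x) :
    etaExp h α δ x ≤ Real.exp (-((δ/(1-h)) * x ^ (2-2*h))) := by
  refine Real.exp_le_exp.2 ?_
  have : 2*α/(1-2*h) * x ^ (1-2*h) ≤ 0 :=
    mul_nonpos_of_nonpos_of_nonneg
      (div_nonpos_of_nonneg_of_nonpos (by linarith) (by linarith)) (rpow_nonneg hx.le _)
  linarith

lemma tendsto_etaExp_atTop {h α δ : ℝ} (hh1 : 1/2 < h) (hh2 : h < 1) (hα : 0 < α) (hδ : 0 < δ) :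
    Tendsto (etaExp h α δ) atTop (𝓝 0) := by
  have h1 : Tendsto (fun x : ℝ => (δ/(1-h)) * x ^ (2-2*h)) atTop atTop :=
    (tendsto_rpow_atTop (by linarith)).const_mul_atTop (div_pos hδ (by linarith))
  refine tendsto_of_tendsto_of_tendsto_of_le_of_le' tendsto_const_nhds
    (tendsto_exp_atBot.comp (tendsto_neg_atTop_atBot.comp h1))
    (Eventually.of_forall fun x => (etaExp_pos h α δ x).le) ?_
  filter_upwards [eventually_gt_atTop 0] with x hx
  exact etaExp_le hh1 hα hx

lemma setIntegral_Ioo_deriv_etaExp {h α δ x : ℝ} (hh1 : 1/2 < h) (hh2 : h < 1) (hα : 0 < α)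
    (hδ : 0 < δ) (hx : 0 < x) :
    ∫ y in Ioo 0 x, etaT h α δ y * (2*α - 2*δ*y) = etaExp h α δ x := by
  have hi : IntervalIntegrable (fun y => etaT h α δ y * (2*α - 2*δ*y)) volume 0 x :=
    (intervalIntegrable_iff_integrableOn_Ioc_of_le hx.le).2
      ((integrableOn_deriv_etaExp hh1 hh2 hα hδ).mono_set Ioc_subset_Ioi_self)
  have := intervalIntegral.integral_eq_sub_of_hasDerivAt_of_tendsto hx
    (fun y hy => hasDerivAt_etaExp hh1 hh2 hy.1) hi (tendsto_etaExp_nhdsGT_zero hh1 hh2 hα)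
    ((hasDerivAt_etaExp (α := α) (δ := δ) hh1 hh2 hx).continuousAt.tendsto.mono_left
      nhdsWithin_le_nhds)
  rwa [intervalIntegral.integral_of_le hx.le, integral_Ioc_eq_integral_Ioo, sub_zero] at this

lemma etaExp_le_setIntegral_Ioo {h α δ x : ℝ} (hh1 : 1/2 < h) (hh2 : h < 1) (hα : 0 < α)
    (hδ : 0 < δ) (hx : 0 < x) :
    etaExp h α δ x ≤ 2*α * ∫ y in Ioo 0 x, etaT h α δ y := by
  rw [← setIntegral_Ioo_deriv_etaExp hh1 hh2 hα hδ hx, ← integral_const_mul]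
  refine setIntegral_mono_on
    ((integrableOn_deriv_etaExp hh1 hh2 hα hδ).mono_set Ioo_subset_Ioi_self)
    (((integrableOn_etaT hh1 hh2 hα hδ).mono_set Ioo_subset_Ioi_self).const_mul _)
    measurableSet_Ioo fun y hy => ?_
  nlinarith [mul_pos (mul_pos (etaT_pos h α δ hy.1) hδ) hy.1]

lemma setIntegral_Ioo_le_etaExp {h α δ x : ℝ} (hh1 : 1/2 < h) (hh2 : h < 1) (hα : 0 < α)
    (hδ : 0 < δ) (hx : 0 < x) (hx' : 2*δ*x ≤ α) :
    α * ∫ y in Ioo 0 x, etaT h α δ y ≤ etaExp h α δ x := by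
  rw [← setIntegral_Ioo_deriv_etaExp hh1 hh2 hα hδ hx, ← integral_const_mul]
  refine setIntegral_mono_on
    (((integrableOn_etaT hh1 hh2 hα hδ).mono_set Ioo_subset_Ioi_self).const_mul _)
    ((integrableOn_deriv_etaExp hh1 hh2 hα hδ).mono_set Ioo_subset_Ioi_self)
    measurableSet_Ioo fun y hy => ?_
  have : 2*δ*y ≤ 2*δ*x := by have := hy.2.le; gcongr
  nlinarith [etaT_pos h α δ hy.1]

lemma setIntegral_Ioi_le_etaExp {h α δ x : ℝ} (hh1 : 1/2 < h) (hh2 : h < 1) (hα : 0 < α)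
    (hδ : 0 < δ) (hx : 0 < x) (hx' : 1 + 2*α ≤ 2*δ*x) :
    ∫ y in Ioi x, etaT h α δ y ≤ etaExp h α δ x := by
  have hi := (integrableOn_deriv_etaExp hh1 hh2 hα hδ).mono_set (Ioi_subset_Ioi hx.le)
  have key := integral_Ioi_of_hasDerivAt_of_tendsto'
    (fun y hy => hasDerivAt_etaExp hh1 hh2 (hx.trans_le hy)) hi
    (tendsto_etaExp_atTop hh1 hh2 hα hδ)
  have : ∫ y in Ioi x, etaT h α δ y ≤ ∫ y in Ioi x, -(etaT h α δ y * (2*α - 2*δ*y)) := by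
    refine setIntegral_mono_on
      ((integrableOn_etaT hh1 hh2 hα hδ).mono_set (Ioi_subset_Ioi hx.le)) hi.neg
      measurableSet_Ioi fun y hy => ?_
    have hy : x < y := hy
    have : 2*δ*x ≤ 2*δ*y := by gcongr
    nlinarith [etaT_pos h α δ (hx.trans hy)]
  rw [integral_neg, key] at this
  linarith

lemma etaExp_div_le_setIntegral_Ioi {h α δ x : ℝ} (hh1 : 1/2 < h) (hh2 : h < 1) (hα : 0 < α)
    (hδ : 0 < δ) (hx : 1 ≤ x) :
    etaExp h α δ x / x ≤ (2*δ+1) * ∫ y in Ioi x, etaT h α δ y := by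
  have hx0 : 0 < x := by linarith
  have hT := (integrableOn_etaT hh1 hh2 hα hδ).mono_set (Ioi_subset_Ioi hx0.le)
  have hpow : ∀ y : ℝ, x < y → etaExp h α δ y / y ^ 2 ≤ etaT h α δ y := fun y hy => by
    have hy0 : 0 < y := hx0.trans hy
    rw [etaT_eq, div_eq_mul_inv, mul_comm, ← rpow_natCast, ← rpow_neg hy0.le]
    have := (etaExp_pos h α δ y).le
    gcongr
    · linarith
    · push_cast; linarith
  have hd : ∀ y ∈ Ici x, HasDerivAt (fun y => etaExp h α δ y / y)
      (etaT h α δ y * (2*α/y - 2*δ) - etaExp h α δ y / y ^ 2) y := fun y hy => by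
    have hy0 : 0 < y := hx0.trans_le hy
    refine ((hasDerivAt_etaExp hh1 hh2 hy0).div (hasDerivAt_id y) hy0.ne').congr_deriv ?_
    simp only [id]
    field_simp
  have hcE : ContinuousOn (etaExp h α δ) (Ioi x) := fun y hy =>
    (hasDerivAt_etaExp hh1 hh2 (hx0.trans hy)).continuousAt.continuousWithinAt
  have hcT : ContinuousOn (etaT h α δ) (Ioi x) :=
    (continuousOn_etaT h α δ).mono (Ioi_subset_Ioi hx0.le)
  have hne : ∀ y ∈ Ioi x, y ≠ 0 := fun y hy => (hx0.trans hy).ne'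
  have hi : IntegrableOn (fun y => etaT h α δ y * (2*α/y - 2*δ) - etaExp h α δ y / y ^ 2)
      (Ioi x) := by
    refine (hT.const_mul (2*α + 2*δ + 1)).mono' (ContinuousOn.aestronglyMeasurable
      ((hcT.mul ((continuousOn_const.div continuousOn_id hne).sub continuousOn_const)).sub
        (hcE.div (continuousOn_id.pow 2) fun y hy => pow_ne_zero 2 (hne y hy)))
      measurableSet_Ioi) ?_
    refine (ae_restrict_iff' measurableSet_Ioi).2 (ae_of_all _ fun y hy => ?_)
    have hy : x < y := hy
    have hy0 : 0 < y := hx0.trans hy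
    have b1 := hpow y hy
    have b2 : 0 ≤ etaExp h α δ y / y ^ 2 := (div_pos (etaExp_pos h α δ y) (by positivity)).le
    have b3 : 2*α/y ≤ 2*α := div_le_self (by linarith) (by linarith)
    have b4 : 0 ≤ 2*α/y := by positivity
    have b5 := etaT_pos h α δ hy0
    rw [Real.norm_eq_abs, abs_le]
    constructor <;> nlinarith [mul_nonneg b5.le b4, mul_nonneg b5.le (sub_nonneg.2 b3),
      mul_pos b5 hδ, mul_pos b5 hα]
  have hlim : Tendsto (fun y => etaExp h α δ y / y) atTop (𝓝 0) :=
    (tendsto_etaExp_atTop hh1 hh2 hα hδ).div_atTop tendsto_id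
  have key := integral_Ioi_of_hasDerivAt_of_tendsto' hd hi hlim
  have : ∫ y in Ioi x, -(etaT h α δ y * (2*α/y - 2*δ) - etaExp h α δ y / y ^ 2) ≤
      ∫ y in Ioi x, (2*δ+1) * etaT h α δ y := by
    refine setIntegral_mono_on hi.neg (hT.const_mul _) measurableSet_Ioi fun y hy => ?_
    have hy0 : 0 < y := hx0.trans hy
    have b4 : 0 ≤ 2*α/y := by positivity
    nlinarith [hpow y hy, mul_nonneg (etaT_pos h α δ hy0).le b4]
  rw [integral_neg, key, integral_const_mul] at this
  linarith

lemma rpow_le_mul_rpow_of_setIntegral_eq {h α δ x₁ x₂ : ℝ} (hh1 : 1/2 < h) (hh2 : h < 1)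
    (hα : 0 < α) (hδ : 0 < δ) (hx₁ : 0 < x₁) (hx₁' : x₁ ≤ 1) (hx₂ : 0 < x₂)
    (hx₂' : 1 + 2*α ≤ 2*δ*x₂)
    (heq : ∫ y in Ioo 0 x₁, etaT h α δ y = ∫ y in Ioi x₂, etaT h α δ y) :
    δ/(1-h) * x₂ ^ (2-2*h) ≤
      (2*α/(2*h-1) + δ/(1-h) + |Real.log (2*α)|) * x₁ ^ (1-2*h) := by
  have h1 := etaExp_le_setIntegral_Ioo hh1 hh2 hα hδ hx₁
  have h2 := (setIntegral_Ioi_le_etaExp hh1 hh2 hα hδ hx₂ hx₂').trans (etaExp_le hh1 hα hx₂)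
  rw [heq] at h1
  have h3 : etaExp h α δ x₁ ≤
      Real.exp (Real.log (2*α) + -((δ/(1-h)) * x₂ ^ (2-2*h))) := by
    rw [Real.exp_add, Real.exp_log (by linarith)]
    exact h1.trans (by gcongr)
  have h4 := Real.exp_le_exp.1 h3
  have e : 2*α/(1-2*h) = -(2*α/(2*h-1)) := by
    rw [← div_neg]; congr 1; ring
  have p1 : 1 ≤ x₁ ^ (1-2*h) := one_le_rpow_of_pos_of_le_one_of_nonpos hx₁ hx₁' (by linarith)
  have p2 : x₁ ^ (2-2*h) ≤ 1 := rpow_le_one hx₁.le hx₁' (by linarith)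
  have hB : 0 < δ/(1-h) := div_pos hδ (by linarith)
  rw [e] at h4
  nlinarith [le_abs_self (Real.log (2*α)), abs_nonneg (Real.log (2*α)),
    mul_le_mul_of_nonneg_left (p2.trans p1) hB.le,
    mul_le_mul_of_nonneg_left p1 (abs_nonneg (Real.log (2*α)))]

lemma exists_boundary_lt (h α δ : ℝ) (hh1 : 1/2 < h) (hh2 : h < 1) (hα : 0 < α) (hδ : 0 < δ) :
    ∃ c₁ c₂ : ℝ, 0 < c₁ ∧ 1 ≤ c₂ ∧ ∀ x₁ x₂ : ℝ, 0 < x₁ → x₁ < c₁ → c₂ < x₂ →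
      (∫ y in Ioo 0 x₁, etaT h α δ y) = (∫ y in Ioi x₂, etaT h α δ y) →
      x₂ ^ h * etaT h α δ x₂ < x₁ ^ h * etaT h α δ x₁ := by
  set K := 2*α/(2*h-1) + δ/(1-h) + |Real.log (2*α)| with hK
  have hB : 0 < δ/(1-h) := div_pos hδ (by linarith)
  have hA : 0 < 2*α/(2*h-1) := div_pos (by linarith) (by linarith)
  have hKpos : 0 < K := by have := abs_nonneg (Real.log (2*α)); linarith
  set L := (2*δ+1)^2 * (K / (δ/(1-h))) with hL
  have hLpos : 0 < L := by positivity
  refine ⟨min 1 (min (α/(2*δ)) (α^2/L)), max 1 ((1+2*α)/(2*δ)),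
    by positivity, le_max_left _ _, fun x₁ x₂ hx₁ hc₁ hc₂ heq => ?_⟩
  simp only [lt_min_iff, lt_div_iff₀ hLpos, lt_div_iff₀ (show 0 < 2*δ by linarith)] at hc₁
  simp only [max_lt_iff, div_lt_iff₀ (show 0 < 2*δ by linarith)] at hc₂
  obtain ⟨a1, a2, a3⟩ := hc₁
  obtain ⟨b1, b2⟩ := hc₂
  have hx₂ : 0 < x₂ := by linarith
  have hboundary : ∀ x : ℝ, 0 < x → x ^ h * etaT h α δ x = x ^ (-h) * etaExp h α δ x :=
    fun x hx => by
      rw [etaT_eq, ← mul_assoc, ← rpow_add hx]; congr 2; ring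
  have hcmp := rpow_le_mul_rpow_of_setIntegral_eq hh1 hh2 hα hδ hx₁ a1.le hx₂ (by linarith) heq
  rw [← hK, ← le_div_iff₀' hB] at hcmp
  have hsq : ((2*δ+1) * x₂ ^ (1-h))^2 < (α * x₁ ^ (-h))^2 := by
    have e1 : (x₂ ^ (1-h))^2 = x₂ ^ (2-2*h) := by
      rw [← rpow_natCast, ← rpow_mul hx₂.le]; congr 1; push_cast; ring
    have e2 : (x₁ ^ (-h))^2 = x₁ ^ (-(2*h)) := by
      rw [← rpow_natCast, ← rpow_mul hx₁.le]; congr 1; push_cast; ring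
    have e3 : x₁ ^ (1-2*h) = x₁ * x₁ ^ (-(2*h)) := by
      rw [sub_eq_add_neg, rpow_add hx₁, rpow_one]
    rw [mul_pow, mul_pow, e1, e2]
    calc (2*δ+1)^2 * x₂ ^ (2-2*h) ≤ (2*δ+1)^2 * (K * x₁ ^ (1-2*h) / (δ/(1-h))) := by gcongr
      _ = x₁ * L * x₁ ^ (-(2*h)) := by rw [e3, hL]; ring
      _ < α^2 * x₁ ^ (-(2*h)) := by
        have := rpow_pos_of_pos hx₁ (-(2*h))
        gcongr
  have hlt : (2*δ+1) * x₂ ^ (1-h) < α * x₁ ^ (-h) :=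
    lt_of_pow_lt_pow_left₀ 2 (by positivity) hsq
  have hF := setIntegral_Ioo_le_etaExp hh1 hh2 hα hδ hx₁ (by linarith)
  have hG := etaExp_div_le_setIntegral_Ioi hh1 hh2 hα hδ b1.le
  have hF' := etaExp_le_setIntegral_Ioo hh1 hh2 hα hδ hx₁
  rw [← heq] at hG
  set r := ∫ y in Ioo 0 x₁, etaT h α δ y
  have hr : 0 < r := pos_of_mul_pos_right ((etaExp_pos h α δ x₁).trans_le hF') (by linarith)
  rw [hboundary _ hx₁, hboundary _ hx₂]
  calc x₂ ^ (-h) * etaExp h α δ x₂ = x₂ ^ (1-h) * (etaExp h α δ x₂ / x₂) := by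
        rw [sub_eq_add_neg, rpow_add hx₂, rpow_one]; field_simp
    _ ≤ x₂ ^ (1-h) * ((2*δ+1) * r) := by gcongr
    _ = ((2*δ+1) * x₂ ^ (1-h)) * r := by ring
    _ < (α * x₁ ^ (-h)) * r := by gcongr
    _ = x₁ ^ (-h) * (α * r) := by ring
    _ ≤ x₁ ^ (-h) * etaExp h α δ x₁ := by gcongr

theorem stmt_8 (h α δ : ℝ) (hh1 : 1/2 < h) (hh2 : h < 1) (hα : 0 < α) (hδ : 0 < δ) :
    ∃ r₀ : ℝ, 0 < r₀ ∧ ∀ x₁ x₂ : ℝ, 0 < x₁ → 0 < x₂ →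
      (∫ y in Set.Ioo 0 x₁, etaN h α δ y) = (∫ y in Set.Ioi x₂, etaN h α δ y) →
      (∫ y in Set.Ioi x₂, etaN h α δ y) ≤ r₀ →
      x₂ ^ h * etaN h α δ x₂ < x₁ ^ h * etaN h α δ x₁ := by
  obtain ⟨c₁, c₂, hc₁, hc₂, hmain⟩ := exists_boundary_lt h α δ hh1 hh2 hα hδ
  have hc₂0 : 0 < c₂ := by linarith
  have hT := integrableOn_etaT hh1 hh2 hα hδ
  have hnn : ∀ s ⊆ Ioi (0:ℝ), MeasurableSet s → 0 ≤ᵐ[volume.restrict s] etaT h α δ :=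
    fun s hs hm => (ae_restrict_iff' hm).2 (ae_of_all _ fun y hy => (etaT_pos h α δ (hs hy)).le)
  have hmono : ∀ s t : Set ℝ, s ⊆ t → t ⊆ Ioi 0 → MeasurableSet t →
      ∫ y in s, etaT h α δ y ≤ ∫ y in t, etaT h α δ y := fun s t hst ht hm =>
    setIntegral_mono_set (hT.mono_set ht) (hnn t ht hm) hst.eventuallyLE
  have hF : 0 < ∫ y in Ioo 0 c₁, etaT h α δ y :=
    pos_of_mul_pos_right
      ((etaExp_pos h α δ c₁).trans_le (etaExp_le_setIntegral_Ioo hh1 hh2 hα hδ hc₁))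
      (by linarith)
  have hG : 0 < ∫ y in Ioi c₂, etaT h α δ y :=
    pos_of_mul_pos_right
      ((div_pos (etaExp_pos h α δ c₂) hc₂0).trans_le
        (etaExp_div_le_setIntegral_Ioi hh1 hh2 hα hδ hc₂))
      (by linarith)
  have hZ : 0 < Zcst h α δ :=
    hF.trans_le (hmono _ _ Ioo_subset_Ioi_self subset_rfl measurableSet_Ioi)
  set m := min (∫ y in Ioo 0 c₁, etaT h α δ y) (∫ y in Ioi c₂, etaT h α δ y)
  have hmpos : 0 < m := lt_min hF hG
  refine ⟨m / 2 / Zcst h α δ, by positivity, fun x₁ x₂ hx₁ hx₂ heq hle => ?_⟩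
  simp only [etaN, integral_div] at heq hle ⊢
  rw [div_left_inj' hZ.ne'] at heq
  rw [div_le_div_iff_of_pos_right hZ] at hle
  have h1 : x₁ < c₁ := by
    by_contra! hcon
    have := hmono _ _ (Ioo_subset_Ioo_right hcon) Ioo_subset_Ioi_self
      measurableSet_Ioo
    linarith [min_le_left (∫ y in Ioo 0 c₁, etaT h α δ y) (∫ y in Ioi c₂, etaT h α δ y)]
  have h2 : c₂ < x₂ := by
    by_contra! hcon
    have := hmono _ _ (Ioi_subset_Ioi hcon) (Ioi_subset_Ioi hx₂.le) measurableSet_Ioi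
    linarith [min_le_right (∫ y in Ioo 0 c₁, etaT h α δ y) (∫ y in Ioi c₂, etaT h α δ y)]
  rw [mul_div_assoc', mul_div_assoc', div_lt_div_iff_of_pos_right hZ]
  exact hmain x₁ x₂ hx₁ h1 h2 heq
end

section
/- Let h, α, δ be real constants with 1/2 < h < 1, α > 0 and δ > 0, and for x > 0 set η̃(x) = x^{-2h}·exp( (2α/(1-2h))·x^{1-2h} - (δ/(1-h))·x^{2-2h} ). Then for every λ with 1/2 < λ < 1 and every ε > 0, ∫₀^∞ η̃(x)·exp( ε·( (1/(1-h))·x^{1-h} )^{2λ/(2λ-1)} ) dx = ∞. -/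
open Real Set MeasureTheory Filter Topology

/-- A function that is eventually at least `1` at infinity has infinite integral over `(0, ∞)`. -/
theorem lintegral_Ioi_ofReal_eq_top_of_eventually_one_le {f : ℝ → ℝ}
    (hf : ∀ᶠ x in atTop, 1 ≤ f x) :
    ∫⁻ x in Set.Ioi (0 : ℝ), ENNReal.ofReal (f x) = ⊤ := by
  obtain ⟨N, hN⟩ := eventually_atTop.1 hf
  refine top_unique ?_
  calc (⊤ : ENNReal) = ∫⁻ _ in Set.Ioi (max N 0), 1 := by simp
    _ ≤ ∫⁻ x in Set.Ioi (max N 0), ENNReal.ofReal (f x) := by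
      refine setLIntegral_mono' measurableSet_Ioi fun x hx => ?_
      rw [← ENNReal.ofReal_one]
      exact ENNReal.ofReal_le_ofReal (hN x ((le_max_left N 0).trans (le_of_lt hx)))
    _ ≤ ∫⁻ x in Set.Ioi (0 : ℝ), ENNReal.ofReal (f x) :=
      lintegral_mono_set (Set.Ioi_subset_Ioi (le_max_right N 0))

/-- A superlinear power dominates any affine function at infinity. -/
theorem tendsto_affine_add_mul_rpow_atTop {r K : ℝ} (hr : 1 < r) (hK : 0 < K) (A B : ℝ) :
    Tendsto (fun y : ℝ => A + B * y + K * y ^ r) atTop atTop := by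
  have h₁ : Tendsto (fun y : ℝ => A + y * (B + K * y ^ (r - 1))) atTop atTop :=
    tendsto_atTop_add_const_left _ _ <| tendsto_id.atTop_mul_atTop₀ <|
      tendsto_atTop_add_const_left _ _ <|
        (tendsto_rpow_atTop (sub_pos.2 hr)).const_mul_atTop hK
  refine h₁.congr' ?_
  filter_upwards [eventually_gt_atTop 0] with y hy
  rw [Real.rpow_sub_one hy.ne']
  field_simp
  ring

theorem stmt_14 (h α δ : ℝ) (hh1 : 1/2 < h) (hh2 : h < 1) (hα : 0 < α) (hδ : 0 < δ)
    (lam : ℝ) (hl1 : 1/2 < lam) (hl2 : lam < 1) (ε : ℝ) (hε : 0 < ε) :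
    ∫⁻ x in Set.Ioi (0:ℝ),
        ENNReal.ofReal (etaT h α δ x *
          Real.exp (ε * ((1/(1-h)) * x ^ (1-h)) ^ (2*lam/(2*lam-1)))) = ⊤ := by
  apply lintegral_Ioi_ofReal_eq_top_of_eventually_one_le
  have hp : 0 < 2 - 2 * h := by linarith
  have hq : 0 < 1 - h := by linarith
  have hl : 0 < 2 * lam - 1 := by linarith
  have hr : 1 < lam / (2 * lam - 1) := by rw [one_lt_div hl]; linarith
  have hK : 0 < ε * (1 / (1 - h)) ^ (2 * lam / (2 * lam - 1)) := by positivity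
  have key := ((tendsto_affine_add_mul_rpow_atTop hr hK (2 * α / (1 - 2 * h))
    (-(2 * h / (2 - 2 * h)) - δ / (1 - h))).comp (tendsto_rpow_atTop hp)).eventually_ge_atTop 0
  filter_upwards [key, eventually_ge_atTop 1] with x hx hx1
  have hx0 : 0 < x := by linarith
  have hpow : ((1 / (1 - h)) * x ^ (1 - h)) ^ (2 * lam / (2 * lam - 1)) =
      (1 / (1 - h)) ^ (2 * lam / (2 * lam - 1)) * (x ^ (2 - 2 * h)) ^ (lam / (2 * lam - 1)) := by
    rw [Real.mul_rpow (by positivity) (by positivity), ← Real.rpow_mul hx0.le,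
      ← Real.rpow_mul hx0.le]
    congr 2
    ring
  have hlog : 2 * h * Real.log x ≤ 2 * h / (2 - 2 * h) * x ^ (2 - 2 * h) := by
    calc 2 * h * Real.log x ≤ 2 * h * (x ^ (2 - 2 * h) / (2 - 2 * h)) :=
          mul_le_mul_of_nonneg_left (Real.log_le_rpow_div hx0.le hp) (by linarith)
      _ = _ := by ring
  have hneg : 2 * α / (1 - 2 * h) ≤ 2 * α / (1 - 2 * h) * x ^ (1 - 2 * h) := by
    have h₁ : x ^ (1 - 2 * h) ≤ 1 := Real.rpow_le_one_of_one_le_of_nonpos hx1 (by linarith)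
    have h₂ : 2 * α / (1 - 2 * h) ≤ 0 :=
      div_nonpos_of_nonneg_of_nonpos (by linarith) (by linarith)
    nlinarith
  rw [etaT, Real.rpow_def_of_pos hx0 (-(2 * h)), ← Real.exp_add, ← Real.exp_add,
    Real.one_le_exp_iff, hpow]
  simp only [Function.comp_apply] at hx
  linarith
end
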